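/- Let s, l ∈ ℝ with l > 4s. Then for every choice of b₁, b₂, b₃ ∈ ℝ there is no constant C > 0 such that ‖∂ₓ(u₁ ū₂)‖_{Y_{l,b₁}} ≤ C ‖u₁‖_{X_{s,b₂}} ‖u₂‖_{X_{s,b₃}} holds for all Schwartz functions u₁, u₂ on ℝ², where ū₂ denotes the complex conjugate of u₂. -/

import Mathlib

open MeasureTheory Real Set
open scoped ENNReal NNReal

noncomputable section

/-- Spacetime Fourier transform of `f : ℝ × ℝ → ℂ` (`p.1` = space frequency ξ, `p.2` = time frequency τ). -/
def FT2 (f : ℝ × ℝ → ℂ) : ℝ × ℝ → ℂ :=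
  fun p => ∫ q : ℝ × ℝ,
    Complex.exp (-(2 * Real.pi * (q.1 * p.1 + q.2 * p.2)) * Complex.I) • f q

/-- Japanese bracket `⟨a⟩ = (1+a²)^{1/2}`. -/
def jb (a : ℝ) : ℝ := Real.sqrt (1 + a ^ 2)

/-- The Bourgain norm `‖f‖_{X_{s,b}(φ)}`, as an `ℝ≥0∞`-valued quantity. -/
def XNorm (φ : ℝ → ℝ) (s b : ℝ) (f : ℝ × ℝ → ℂ) : ℝ≥0∞ :=
  (∫⁻ p : ℝ × ℝ,
    ENNReal.ofReal (jb p.1 ^ (2 * s) * jb (p.2 + φ p.1) ^ (2 * b) * ‖FT2 f p‖ ^ 2)) ^ (1/2 : ℝ)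

/-- Schrödinger phase `φ(ξ) = ξ²`. -/
def SchPhase : ℝ → ℝ := fun ξ => ξ ^ 2

/-- Conjugate Schrödinger phase `φ(ξ) = -ξ²`. -/
def SchPhaseNeg : ℝ → ℝ := fun ξ => -ξ ^ 2

/-- Airy (KdV) phase `φ(ξ) = -ξ³`. -/
def AiryPhase : ℝ → ℝ := fun ξ => -ξ ^ 3

/-- `f` has a nonnegative (real-valued) spacetime Fourier transform. -/
def HasNonnegFT (f : ℝ × ℝ → ℂ) : Prop :=
  ∀ p, (FT2 f p).im = 0 ∧ 0 ≤ (FT2 f p).re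

/-- The weighted trilinear functional `I_m(f̂,ĝ,ĥ)`, applied here directly to
the Fourier transforms `F = f̂`, `G = ĝ`, `H = ĥ` (assumed nonnegative). -/
def Itri (m : ℝ → ℝ → ℝ) (F G H : ℝ × ℝ → ℂ) : ℝ≥0∞ :=
  ∫⁻ q : (ℝ × ℝ) × (ℝ × ℝ),
    ENNReal.ofReal
      (m q.1.1 q.2.1 * (F (q.1.1 + q.2.1, q.1.2 + q.2.2)).re * (G q.1).re * (H q.2).re)

/-- Partial derivative in the spatial variable `x` (first coordinate). -/
def partialX (f : ℝ × ℝ → ℂ) : ℝ × ℝ → ℂ :=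
  fun p => deriv (fun x => f (x, p.2)) p.1

/-- Multiplication by the rescaled time cutoff, `(ψ(t/δ)f)(x,t) = ψ(t/δ) f(x,t)`. -/
def timeCut (ψ : ℝ → ℝ) (δ : ℝ) (f : ℝ × ℝ → ℂ) : ℝ × ℝ → ℂ :=
  fun p => (ψ (p.2 / δ) : ℂ) * f p

/-- `ψ` is a fixed even smooth bump, `0 ≤ ψ ≤ 1`, `ψ ≡ 1` on `[-1,1]`, supp ψ ⊆ `[-2,2]`. -/
def IsTimeBump (ψ : ℝ → ℝ) : Prop :=
  ContDiff ℝ (⊤ : ℕ∞) ψ ∧ HasCompactSupport ψ ∧ (∀ t, ψ (-t) = ψ t) ∧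
  (∀ t, 0 ≤ ψ t ∧ ψ t ≤ 1) ∧ (∀ t ∈ Set.Icc (-1 : ℝ) 1, ψ t = 1) ∧
  Function.support ψ ⊆ Set.Icc (-2 : ℝ) 2

/-- `m` is an admissible symbol `m_{N,s}` for the smoothing operator `I_{N,s}`. -/
def IsISymbol (N s : ℝ) (m : ℝ → ℝ) : Prop :=
  ContDiff ℝ (⊤ : ℕ∞) m ∧ (∀ ξ, m (-ξ) = m ξ) ∧
  (∀ ξ, 0 < m ξ ∧ m ξ ≤ 1) ∧
  (∀ ξ η, |ξ| ≤ |η| → m η ≤ m ξ) ∧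
  (∀ ξ, |ξ| ≤ N → m ξ = 1) ∧
  (∀ ξ, 2 * N ≤ |ξ| → m ξ = N ^ (1 - s) * |ξ| ^ (s - 1))

/-- Inverse spacetime Fourier transform. -/
def invFT2 (f : ℝ × ℝ → ℂ) : ℝ × ℝ → ℂ :=
  fun p => ∫ q : ℝ × ℝ,
    Complex.exp ((2 * Real.pi * (q.1 * p.1 + q.2 * p.2)) * Complex.I) • f q

/-- The Fourier multiplier operator (in `x`) with symbol `m(ξ)`. -/
def Iop (m : ℝ → ℝ) (f : ℝ × ℝ → ℂ) : ℝ × ℝ → ℂ :=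
  invFT2 (fun q => (m q.1 : ℂ) * FT2 f q)

/-- The restricted Bourgain norm `‖f‖_{X^E_{s,b}(φ)}`. -/
def XRestNorm (φ : ℝ → ℝ) (s b : ℝ) (E : Set ℝ) (f : ℝ × ℝ → ℂ) : ℝ≥0∞ :=
  ⨅ F ∈ {F : ℝ × ℝ → ℂ | XNorm φ s b F < ⊤ ∧ ∀ x t, t ∈ E → F (x, t) = f (x, t)},
    XNorm φ s b F


open scoped FourierTransform

def wv (χ : ℝ → ℂ) (M a : ℝ) : ℝ → ℂ :=
  fun x => Complex.exp (2 * Real.pi * (a * x) * Complex.I) * χ (x / M)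

def pk (χ : ℝ → ℂ) (M a c : ℝ) : ℝ × ℝ → ℂ := fun p => wv χ M a p.1 * wv χ 1 c p.2

lemma four_eq (v : ℝ → ℂ) (ξ : ℝ) :
    𝓕 v ξ = ∫ x : ℝ, Complex.exp (-(2 * Real.pi * (x * ξ)) * Complex.I) * v x := by
  rw [Real.fourier_real_eq_integral_exp_smul]
  refine integral_congr_ae (Filter.Eventually.of_forall fun x => ?_)
  simp only [smul_eq_mul]
  congr 2
  push_cast
  ring

lemma FT2_prod (v w : ℝ → ℂ) (p : ℝ × ℝ) :
    FT2 (fun p => v p.1 * w p.2) p = 𝓕 v p.1 * 𝓕 w p.2 := by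
  rw [four_eq, four_eq, ← integral_prod_mul]
  unfold FT2
  refine integral_congr_ae (Filter.Eventually.of_forall fun q => ?_)
  simp only [smul_eq_mul]
  have : (-(2 * (Real.pi : ℂ) * (q.1 * p.1 + q.2 * p.2)) * Complex.I)
    = -(2 * Real.pi * (q.1 * p.1)) * Complex.I + -(2 * Real.pi * (q.2 * p.2)) * Complex.I := by ring
  rw [this, Complex.exp_add]
  ring

lemma four_wv (χ : ℝ → ℂ) {M : ℝ} (hM : 0 < M) (a η : ℝ) :
    𝓕 (wv χ M a) (a + η / M) = M * 𝓕 χ η := by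
  rw [four_eq, four_eq]
  have h := Measure.integral_comp_div
    (fun y : ℝ => Complex.exp (-(2 * Real.pi * (y * η)) * Complex.I) * χ y) M
  rw [abs_of_pos hM, Complex.real_smul] at h
  rw [← h]
  refine integral_congr_ae (Filter.Eventually.of_forall fun x => ?_)
  simp only [wv]
  rw [← mul_assoc, ← Complex.exp_add]
  congr 2
  have hM' : (M : ℂ) ≠ 0 := by exact_mod_cast hM.ne'
  push_cast
  field_simp
  ring

lemma FT2_pk (χ : ℝ → ℂ) {M : ℝ} (hM : 0 < M) (a c η σ : ℝ) :
    FT2 (pk χ M a c) (a + η / M, c + σ) = M * 𝓕 χ η * 𝓕 χ σ := by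
  have := FT2_prod (wv χ M a) (wv χ 1 c) (a + η / M, c + σ)
  have h2 := four_wv χ one_pos c σ
  simp only [div_one] at h2
  unfold pk
  rw [this]
  simp only
  rw [four_wv χ hM, h2]
  push_cast; ring

lemma contDiff_wv {χ : ℝ → ℂ} (h : ContDiff ℝ (⊤ : ℕ∞) χ) (M a : ℝ) :
    ContDiff ℝ (⊤ : ℕ∞) (wv χ M a) := by
  unfold wv
  apply ContDiff.mul
  · apply ContDiff.cexp
    have : ContDiff ℝ (⊤ : ℕ∞) (fun x : ℝ => (x : ℂ)) := Complex.ofRealCLM.contDiff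
    fun_prop
  · exact h.comp (contDiff_id.div_const M)

lemma comp_wv {χ : ℝ → ℂ} (h : HasCompactSupport χ) {M : ℝ} (hM : 0 < M) (a : ℝ) :
    HasCompactSupport (wv χ M a) := by
  unfold wv
  apply HasCompactSupport.mul_left
  have := h.comp_homeomorph (Homeomorph.mulRight₀ M⁻¹ (inv_ne_zero hM.ne'))
  rw [show (fun x => χ (x / M)) = χ ∘ ⇑(Homeomorph.mulRight₀ M⁻¹ (inv_ne_zero hM.ne')) by
    funext x; simp [div_eq_mul_inv]]
  exact this

lemma contDiff_pk {χ : ℝ → ℂ} (h : ContDiff ℝ (⊤ : ℕ∞) χ) (M a c : ℝ) :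
    ContDiff ℝ (⊤ : ℕ∞) (pk χ M a c) := by
  unfold pk
  exact ((contDiff_wv h M a).comp contDiff_fst).mul ((contDiff_wv h 1 c).comp contDiff_snd)

lemma comp_pk {χ : ℝ → ℂ} (h : HasCompactSupport χ) {M : ℝ} (hM : 0 < M) (a c : ℝ) :
    HasCompactSupport (pk χ M a c) := by
  refine HasCompactSupport.intro ((comp_wv h hM a).prod (comp_wv h one_pos c)) ?_
  intro p hp
  by_contra hne
  apply hp
  unfold pk at hne
  exact ⟨subset_tsupport _ (left_ne_zero_of_mul hne), subset_tsupport _ (right_ne_zero_of_mul hne)⟩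

lemma FT2_dpk {χ : ℝ → ℂ} (hs : ContDiff ℝ (⊤ : ℕ∞) χ) (h : HasCompactSupport χ) {M : ℝ}
    (hM : 0 < M) (a c η σ : ℝ) :
    FT2 (partialX (pk χ M a c)) (a + η / M, c + σ) =
      (2 * Real.pi * Complex.I * (a + η / M : ℝ)) * (M * 𝓕 χ η * 𝓕 χ σ) := by
  have e : partialX (pk χ M a c) = fun p => deriv (wv χ M a) p.1 * wv χ 1 c p.2 := by
    funext p
    unfold partialX pk
    simp only
    rw [deriv_mul_const]
    exact ((contDiff_wv hs M a).differentiable (by simp)) _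
  have hc := contDiff_wv hs M a
  have h1 : Integrable (wv χ M a) := hc.continuous.integrable_of_hasCompactSupport (comp_wv h hM a)
  have h2 : Integrable (deriv (wv χ M a)) :=
    (hc.continuous_deriv (by simp)).integrable_of_hasCompactSupport (comp_wv h hM a).deriv
  rw [e, FT2_prod, Real.fourier_deriv h1 (hc.differentiable (by simp)) h2, ← FT2_pk χ hM]
  unfold pk
  rw [FT2_prod]
  simp only [smul_eq_mul]
  ring

lemma pk_mul_conj (g : ℝ → ℝ) (M a₁ c₁ a₂ c₂ : ℝ) (p : ℝ × ℝ) :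
    pk (fun x => (g x : ℂ)) M a₁ c₁ p * (starRingEnd ℂ) (pk (fun x => (g x : ℂ)) M a₂ c₂ p)
      = pk (fun x => ((g x ^ 2 : ℝ) : ℂ)) M (a₁ - a₂) (c₁ - c₂) p := by
  unfold pk wv
  simp only [map_mul, ← Complex.exp_conj, Complex.conj_ofReal, Complex.conj_I, map_ofNat]
  have e1 : 2 * (Real.pi : ℂ) * ((a₁ - a₂ : ℝ) * p.1) * Complex.I
    = 2 * Real.pi * (a₁ * p.1) * Complex.I + 2 * Real.pi * (a₂ * p.1) * -Complex.I := by
    push_cast; ring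
  have e2 : 2 * (Real.pi : ℂ) * ((c₁ - c₂ : ℝ) * p.2) * Complex.I
    = 2 * Real.pi * (c₁ * p.2) * Complex.I + 2 * Real.pi * (c₂ * p.2) * -Complex.I := by
    push_cast; ring
  rw [e1, e2, Complex.exp_add, Complex.exp_add]
  push_cast
  ring

lemma lint_1d (G : ℝ → ℝ≥0∞) {M : ℝ} (hM : 0 < M) (a : ℝ) :
    ∫⁻ x, G x = ENNReal.ofReal M⁻¹ * ∫⁻ η, G (a + η / M) := by
  have h1 : ∫⁻ η, G (a + η / M) = ∫⁻ x, G (a + x) ∂(Measure.map (fun η : ℝ => M⁻¹ * η) volume) := by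
    have := (MeasurableEquiv.mulLeft₀ M⁻¹ (inv_ne_zero hM.ne')).measurableEmbedding.lintegral_map
      (μ := volume) (fun x => G (a + x))
    rw [show (fun η : ℝ => M⁻¹ * η) = ⇑(MeasurableEquiv.mulLeft₀ M⁻¹ (inv_ne_zero hM.ne')) from rfl,
      this]
    simp [div_eq_inv_mul]
  rw [h1, Real.map_volume_mul_left (inv_ne_zero hM.ne'), lintegral_smul_measure,
    lintegral_add_left_eq_self, inv_inv, abs_of_pos hM, smul_eq_mul, ← mul_assoc,
    ← ENNReal.ofReal_mul (by positivity), inv_mul_cancel₀ hM.ne']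
  simp

lemma lint_2d (G : ℝ × ℝ → ℝ≥0∞) (hG : Measurable G) {M : ℝ} (hM : 0 < M) (a c : ℝ) :
    ∫⁻ p, G p = ENNReal.ofReal M⁻¹ * ∫⁻ q : ℝ × ℝ, G (a + q.1 / M, c + q.2) := by
  rw [Measure.volume_eq_prod, lintegral_prod _ hG.aemeasurable, lintegral_prod _ (by fun_prop),
    lint_1d _ hM a]
  congr 1
  refine lintegral_congr fun η => ?_
  simp only
  rw [lintegral_add_left_eq_self (fun y => G (a + η / M, y))]

lemma jb_one_le (a : ℝ) : 1 ≤ jb a := by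
  unfold jb; rw [Real.one_le_sqrt]; nlinarith [sq_nonneg a]
lemma jb_pos (a : ℝ) : 0 < jb a := by linarith [jb_one_le a]
lemma jb_sq (a : ℝ) : jb a ^ 2 = 1 + a ^ 2 := Real.sq_sqrt (by positivity)
lemma jb_cont : Continuous jb := by unfold jb; fun_prop
lemma jb_le (a : ℝ) : jb a ≤ 1 + |a| := by
  apply Real.sqrt_le_iff.2; constructor
  · positivity
  · nlinarith [sq_abs a, abs_nonneg a]
lemma abs_le_jb (a : ℝ) : |a| ≤ jb a := by
  apply Real.le_sqrt_of_sq_le; rw [sq_abs]; linarith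
lemma jb_add (a y : ℝ) : jb (a + y) ≤ 2 * jb a * jb y := by
  apply Real.sqrt_le_iff.2
  have h1 := jb_pos a
  have h2 := jb_pos y
  constructor
  · positivity
  · rw [mul_pow, mul_pow, jb_sq, jb_sq]
    nlinarith [sq_nonneg (a - y), sq_nonneg a, sq_nonneg y, mul_nonneg (sq_nonneg a) (sq_nonneg y)]

/-- comparability to powers -/
lemma rpow_comp {x y K : ℝ} (hx : 0 < x) (hy : 0 < y) (hK : 1 ≤ K) (h1 : x ≤ K * y)
    (h2 : y ≤ K * x) (r : ℝ) : x ^ r ≤ K ^ |r| * y ^ r := by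
  have hK0 : 0 < K := by linarith
  rcases le_total 0 r with hr | hr
  · rw [abs_of_nonneg hr, ← Real.mul_rpow hK0.le hy.le]
    exact Real.rpow_le_rpow hx.le h1 hr
  · rw [abs_of_nonpos hr]
    have h3 : y / K ≤ x := by rw [div_le_iff₀ hK0]; linarith
    have := Real.rpow_le_rpow_of_nonpos (by positivity) h3 hr
    rwa [Real.div_rpow hy.le hK0.le, div_eq_mul_inv, ← Real.rpow_neg hK0.le, mul_comm] at this

lemma jb_peetre (a y r : ℝ) : jb (a + y) ^ r ≤ (2 * jb y) ^ |r| * jb a ^ r := by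
  apply rpow_comp (jb_pos _) (jb_pos _)
  · linarith [jb_one_le y]
  · linarith [jb_add a y]
  · have := jb_add (a + y) (-y)
    have e : jb (-y) = jb y := by unfold jb; simp
    rw [e] at this
    simp only [add_neg_cancel_right] at this
    linarith

lemma cont_four {v : ℝ → ℂ} (hv : Integrable v) : Continuous (𝓕 v) :=
  VectorFourier.fourierIntegral_continuous Real.continuous_fourierChar
    (by exact continuous_inner) hv

lemma XNorm_eq {φ : ℝ → ℝ} (hφ : Continuous φ) (s b : ℝ) {v w : ℝ → ℂ} (hv : Integrable v)
    (hw : Integrable w) {M : ℝ} (hM : 0 < M) (a c : ℝ) :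
    XNorm φ s b (fun p => v p.1 * w p.2) = (ENNReal.ofReal M⁻¹ * ∫⁻ q : ℝ × ℝ,
      ENNReal.ofReal (jb (a + q.1 / M) ^ (2 * s) * jb (c + q.2 + φ (a + q.1 / M)) ^ (2 * b) *
        ‖FT2 (fun p => v p.1 * w p.2) (a + q.1 / M, c + q.2)‖ ^ 2)) ^ (1/2 : ℝ) := by
  unfold XNorm
  rw [lint_2d _ ?_ hM a c]
  have e : FT2 (fun p => v p.1 * w p.2) = fun p => 𝓕 v p.1 * 𝓕 w p.2 := by
    funext p; exact FT2_prod v w p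
  rw [e]
  have h1 := cont_four hv
  have h2 := cont_four hw
  have h3 := jb_cont
  have h4 := h3.measurable
  have h5 := hφ.measurable
  have h6 := h1.measurable
  have h7 := h2.measurable
  fun_prop

lemma wt_fin {χ : ℝ → ℂ} (hs : ContDiff ℝ (⊤ : ℕ∞) χ) (h : HasCompactSupport χ) (r : ℝ) :
    ∫⁻ η, ENNReal.ofReal (jb η ^ r * ‖𝓕 χ η‖ ^ 2) < ⊤ := by
  obtain ⟨k, hk⟩ := exists_nat_ge (r / 2)
  let F : SchwartzMap ℝ ℂ := 𝓕 (h.toSchwartzMap hs)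
  have hF : ∀ η, F η = 𝓕 χ η := by
    intro η
    have := SchwartzMap.fourier_coe (h.toSchwartzMap hs)
    exact congrFun this η
  obtain ⟨C, hC⟩ : ∃ C, ∀ η, (1 + ‖η‖) ^ (k + 1) * ‖F η‖ ≤ C := by
    refine ⟨2 ^ (k + 1) * ((Finset.Iic (k + 1, 0)).sup fun m => SchwartzMap.seminorm ℝ m.1 m.2) F,
      fun η => ?_⟩
    have := SchwartzMap.one_add_le_sup_seminorm_apply (𝕜 := ℝ) (m := (k+1, 0)) (le_refl (k+1))
      (le_refl 0) F η
    simpa using this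
  have hint : Integrable fun η : ℝ => C ^ 2 * (1 + η ^ 2)⁻¹ :=
    integrable_inv_one_add_sq.const_mul _
  refine lt_of_le_of_lt (lintegral_mono fun η => ENNReal.ofReal_le_ofReal ?_)
    hint.lintegral_lt_top
  rw [← hF, ← jb_sq]
  have hj := jb_one_le η
  have hj0 := jb_pos η
  have h1 : jb η ^ (k + 1) * ‖F η‖ ≤ C :=
    le_trans (by gcongr; exact jb_le η) (hC η)
  have h2 : jb η ^ r ≤ (jb η ^ k) ^ 2 := by
    rw [← pow_mul, ← Real.rpow_natCast]
    apply Real.rpow_le_rpow_of_exponent_le hj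
    push_cast; linarith
  rw [← div_eq_mul_inv, le_div_iff₀ (by positivity)]
  calc jb η ^ r * ‖F η‖ ^ 2 * jb η ^ 2 ≤ (jb η ^ k) ^ 2 * ‖F η‖ ^ 2 * jb η ^ 2 := by gcongr
    _ = (jb η ^ (k+1) * ‖F η‖) ^ 2 := by ring
    _ ≤ C ^ 2 := by gcongr

lemma ofReal_half {x : ℝ} (hx : 0 ≤ x) :
    (ENNReal.ofReal x) ^ (1/2 : ℝ) = ENNReal.ofReal (√x) := by
  rw [ENNReal.ofReal_rpow_of_nonneg hx (by norm_num), Real.sqrt_eq_rpow]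

lemma upper {χ : ℝ → ℂ} (hs : ContDiff ℝ (⊤ : ℕ∞) χ) (h : HasCompactSupport χ) (s b : ℝ) :
    ∃ K : ℝ, 0 < K ∧ ∀ M a : ℝ, 1 ≤ M → |a| ≤ M →
      XNorm SchPhase s b (pk χ M a (-a ^ 2)) ≤ ENNReal.ofReal (√(M * K * jb a ^ (2 * s))) := by
  set A := |2 * s|
  set B := |2 * b|
  set c : ℝ := 2 ^ A * 4 ^ B with hc
  set W1 := ∫⁻ η, ENNReal.ofReal (jb η ^ (A + 2 * B) * ‖𝓕 χ η‖ ^ 2) with hW1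
  set W2 := ∫⁻ η, ENNReal.ofReal (jb η ^ B * ‖𝓕 χ η‖ ^ 2) with hW2
  have w1 : W1 < ⊤ := wt_fin hs h _
  have w2 : W2 < ⊤ := wt_fin hs h _
  have hA : 0 ≤ A := abs_nonneg _
  have hB : 0 ≤ B := abs_nonneg _
  have hc0 : 0 < c := by positivity
  have hχ : Integrable χ := hs.continuous.integrable_of_hasCompactSupport h
  have hm := (cont_four hχ).measurable
  have hjm := jb_cont.measurable
  refine ⟨c * (W1 * W2).toReal + 1, by positivity, fun M a hM ha => ?_⟩
  have hM0 : 0 < M := by linarith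
  have hv : Integrable (wv χ M a) :=
    (contDiff_wv hs M a).continuous.integrable_of_hasCompactSupport (comp_wv h hM0 a)
  have hw : Integrable (wv χ 1 (-a ^ 2)) :=
    (contDiff_wv hs 1 _).continuous.integrable_of_hasCompactSupport (comp_wv h one_pos _)
  have e := XNorm_eq (φ := SchPhase) (by unfold SchPhase; fun_prop) s b hv hw hM0 a (-a^2)
  change XNorm SchPhase s b (pk χ M a (-a ^ 2)) = _ at e
  have hja := jb_pos a
  rw [e, ← ofReal_half (by positivity)]
  apply ENNReal.rpow_le_rpow _ (by norm_num)
  have key : ∀ q : ℝ × ℝ, ENNReal.ofReal (jb (a + q.1 / M) ^ (2 * s) *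
      jb (-a ^ 2 + q.2 + SchPhase (a + q.1 / M)) ^ (2 * b) *
        ‖FT2 (fun p => wv χ M a p.1 * wv χ 1 (-a ^ 2) p.2) (a + q.1 / M, -a ^ 2 + q.2)‖ ^ 2)
      ≤ ENNReal.ofReal (M ^ 2 * jb a ^ (2 * s) * c) *
        (ENNReal.ofReal (jb q.1 ^ (A + 2 * B) * ‖𝓕 χ q.1‖ ^ 2) *
          ENNReal.ofReal (jb q.2 ^ B * ‖𝓕 χ q.2‖ ^ 2)) := by
    rintro ⟨η, σ⟩
    have hjη := jb_pos η
    have hjσ := jb_pos σ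
    have hjη1 := jb_one_le η
    have hjσ1 := jb_one_le σ
    simp only
    rw [← ENNReal.ofReal_mul (by positivity), ← ENNReal.ofReal_mul (by positivity)]
    apply ENNReal.ofReal_le_ofReal
    change _ * _ * ‖FT2 (pk χ M a (-a ^ 2)) _‖ ^ 2 ≤ _
    rw [FT2_pk χ hM0]
    have hle : |η / M| ≤ |η| := by
      rw [abs_div, abs_of_pos hM0]; exact div_le_self (abs_nonneg _) hM
    have hle2 : jb (η / M) ≤ jb η := by
      unfold jb
      apply Real.sqrt_le_sqrt
      have := sq_le_sq.2 hle
      linarith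
    have p1 : jb (a + η / M) ^ (2 * s) ≤ (2 * jb η) ^ A * jb a ^ (2 * s) := by
      refine (jb_peetre a (η / M) (2 * s)).trans ?_
      have := jb_pos (η / M)
      gcongr
    set m := -a ^ 2 + σ + SchPhase (a + η / M) with hmdef
    have hm' : m = σ + 2 * (a / M) * η + (η / M) ^ 2 := by
      rw [hmdef]; unfold SchPhase; field_simp; ring
    have ham : |a / M| ≤ 1 := by
      rw [abs_div, abs_of_pos hM0]; exact div_le_one_of_le₀ ha hM0.le
    have hmabs : |m| ≤ |σ| + 2 * |η| + η ^ 2 := by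
      rw [hm']
      refine (abs_add_three _ _ _).trans ?_
      have h1 : |2 * (a / M) * η| ≤ 2 * |η| := by
        rw [abs_mul, abs_mul, abs_two]
        nlinarith [abs_nonneg η]
      have h2 : |(η / M) ^ 2| ≤ η ^ 2 := by
        rw [abs_of_nonneg (sq_nonneg _)]; exact sq_le_sq.2 hle
      linarith
    have hjm' : jb m ≤ 4 * jb σ * jb η ^ 2 := by
      have h1 := jb_le m
      have h2 := abs_le_jb σ
      have h3 : (1 + |η|) ^ 2 ≤ 2 * jb η ^ 2 := by
        rw [jb_sq]; nlinarith [sq_abs η, sq_nonneg (1 - |η|)]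
      have h4 : 1 ≤ jb η ^ 2 := one_le_pow₀ hjη1
      nlinarith [sq_abs η]
    have p2 : jb m ^ (2 * b) ≤ (4 * jb σ * jb η ^ 2) ^ B := by
      calc jb m ^ (2 * b) ≤ jb m ^ B :=
            Real.rpow_le_rpow_of_exponent_le (jb_one_le m) (le_abs_self _)
        _ ≤ _ := Real.rpow_le_rpow (jb_pos m).le hjm' hB
    have e1 : (2 * jb η) ^ A = 2 ^ A * jb η ^ A := Real.mul_rpow (by norm_num) hjη.le
    have e2 : (4 * jb σ * jb η ^ 2) ^ B = 4 ^ B * jb σ ^ B * jb η ^ (2 * B) := by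
      rw [Real.mul_rpow (by positivity) (by positivity), Real.mul_rpow (by norm_num) hjσ.le,
        Real.rpow_mul hjη.le]
      norm_cast
    have e3 : jb η ^ (A + 2 * B) = jb η ^ A * jb η ^ (2 * B) := Real.rpow_add hjη _ _
    have hjm0 := jb_pos m
    have hj0 := jb_pos (a + η / M)
    have en : ‖(M : ℂ) * 𝓕 χ η * 𝓕 χ σ‖ = M * ‖𝓕 χ η‖ * ‖𝓕 χ σ‖ := by
      rw [norm_mul, norm_mul, Complex.norm_real, Real.norm_of_nonneg hM0.le]
    rw [en]
    calc _ ≤ ((2 * jb η) ^ A * jb a ^ (2 * s)) * (4 * jb σ * jb η ^ 2) ^ B *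
          (M * ‖𝓕 χ η‖ * ‖𝓕 χ σ‖) ^ 2 := by gcongr
      _ = _ := by rw [e1, e2, e3, hc]; ring
  refine (mul_le_mul_right (lintegral_mono key) _).trans ?_
  rw [lintegral_const_mul _ (by fun_prop), Measure.volume_eq_prod,
    lintegral_prod_mul (f := fun η => ENNReal.ofReal (jb η ^ (A + 2 * B) * ‖𝓕 χ η‖ ^ 2))
      (g := fun η => ENNReal.ofReal (jb η ^ B * ‖𝓕 χ η‖ ^ 2)) (by fun_prop) (by fun_prop), ← hW1, ← hW2,
    ← ENNReal.ofReal_toReal (ENNReal.mul_lt_top w1 w2).ne,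
    ← ENNReal.ofReal_mul (by positivity), ← ENNReal.ofReal_mul (by positivity)]
  apply ENNReal.ofReal_le_ofReal
  have : M⁻¹ * (M ^ 2 * jb a ^ (2 * s) * c * (W1 * W2).toReal)
     = M * (c * (W1 * W2).toReal) * jb a ^ (2 * s) := by field_simp
  rw [this]
  gcongr
  rw [ENNReal.toReal_ofReal ENNReal.toReal_nonneg]
  linarith

lemma lower {χ : ℝ → ℂ} (hs : ContDiff ℝ (⊤ : ℕ∞) χ) (h : HasCompactSupport χ)
    (h0 : 𝓕 χ 0 ≠ 0) (l b : ℝ) :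
    ∃ k : ℝ, 0 < k ∧ ∀ N : ℝ, 2 ≤ N →
      ENNReal.ofReal (√(k * N ^ (2 * l) * N ^ 4)) ≤
        XNorm AiryPhase l b (partialX (pk χ (N ^ 2) N (N ^ 3))) := by
  have hχ : Integrable χ := hs.continuous.integrable_of_hasCompactSupport h
  have hcont := cont_four hχ
  obtain ⟨c, hc, δ, hδ, hδ1, hlow⟩ : ∃ c : ℝ, 0 < c ∧ ∃ δ : ℝ, 0 < δ ∧ δ ≤ 1 ∧
      ∀ η ∈ Icc (-δ) δ, c ≤ ‖𝓕 χ η‖ := by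
    have hn : 0 < ‖𝓕 χ 0‖ := norm_pos_iff.2 h0
    have := (hcont.norm.continuousAt (x := (0:ℝ))).eventually_const_lt (half_lt_self hn)
    obtain ⟨ε, hε, hb⟩ := Metric.eventually_nhds_iff.1 this
    refine ⟨_, half_pos hn, min (ε / 2) 1, by positivity, min_le_right _ _, fun η hη => ?_⟩
    refine (hb ?_).le
    rw [Real.dist_eq, sub_zero]
    have := abs_le.2 hη
    have := min_le_left (ε / 2) 1
    linarith
  set P : ℝ := 4 ^ |2 * l| with hP
  set Q : ℝ := 9 ^ |2 * b| with hQ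
  have hP0 : 0 < P := by positivity
  have hQ0 : 0 < Q := by positivity
  refine ⟨P⁻¹ * Q⁻¹ * c ^ 4 / 4 * (2 * δ) ^ 2, by positivity, fun N hN => ?_⟩
  have hN0 : 0 < N := by linarith
  have hM0 : 0 < N ^ 2 := by positivity
  have hd : partialX (pk χ (N^2) N (N^3)) =
      fun p => deriv (wv χ (N^2) N) p.1 * wv χ 1 (N^3) p.2 := by
    funext p
    unfold partialX pk
    simp only
    rw [deriv_mul_const]
    exact ((contDiff_wv hs _ _).differentiable (by simp)) _
  have hv : Integrable (deriv (wv χ (N^2) N)) :=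
    ((contDiff_wv hs _ _).continuous_deriv (by simp)).integrable_of_hasCompactSupport
      (comp_wv h hM0 _).deriv
  have hw : Integrable (wv χ 1 (N ^ 3)) :=
    (contDiff_wv hs 1 _).continuous.integrable_of_hasCompactSupport (comp_wv h one_pos _)
  have e := XNorm_eq (φ := AiryPhase) (by unfold AiryPhase; fun_prop) l b hv hw hM0 N (N ^ 3)
  rw [← hd] at e
  rw [e, ← ofReal_half (by positivity)]
  apply ENNReal.rpow_le_rpow _ (by norm_num)
  set S : Set (ℝ × ℝ) := Icc (-δ) δ ×ˢ Icc (-δ) δ with hS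
  have hSm : MeasurableSet S := measurableSet_Icc.prod measurableSet_Icc
  have hvol : (volume : Measure (ℝ × ℝ)) S = ENNReal.ofReal ((2 * δ) ^ 2) := by
    rw [hS, Measure.volume_eq_prod, Measure.prod_prod, Real.volume_Icc,
      ← ENNReal.ofReal_mul (by linarith)]
    congr 1; ring
  have key : ∀ q ∈ S, ENNReal.ofReal (P⁻¹ * Q⁻¹ * c ^ 4 / 4 * N ^ (2 * l) * N ^ 6) ≤
      ENNReal.ofReal (jb (N + q.1 / N ^ 2) ^ (2 * l) *
      jb (N ^ 3 + q.2 + AiryPhase (N + q.1 / N ^ 2)) ^ (2 * b) *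
        ‖FT2 (partialX (pk χ (N^2) N (N^3))) (N + q.1 / N ^ 2, N ^ 3 + q.2)‖ ^ 2) := by
    rintro ⟨η, σ⟩ ⟨h1, h2⟩
    simp only at h1 h2 ⊢
    apply ENNReal.ofReal_le_ofReal
    rw [FT2_dpk hs h hM0]
    have l1 := hlow η h1
    have l2 := hlow σ h2
    set ζ := η / N ^ 2 with hζ
    have hη : |η| ≤ 1 := (abs_le.2 h1).trans hδ1
    have hσ : |σ| ≤ 1 := (abs_le.2 h2).trans hδ1
    have hζη : ζ * N ^ 2 = η := by rw [hζ]; field_simp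
    have hζ1 : |ζ| ≤ 1 := by
      rw [hζ, abs_div, abs_of_pos hM0]
      exact div_le_one_of_le₀ (by nlinarith) hM0.le
    have hζN : |ζ * N| ≤ 1 := by
      rw [show ζ * N = η / N by rw [hζ]; field_simp, abs_div, abs_of_pos hN0]
      exact div_le_one_of_le₀ (by linarith) hN0.le
    obtain ⟨z1, z2⟩ := abs_le.1 hζ1
    have b1 : jb (N + ζ) ≤ 4 * N := by
      have := jb_le (N + ζ)
      rw [abs_of_pos (by linarith)] at this
      linarith
    have b2 : N ≤ 4 * jb (N + ζ) := by
      have := abs_le_jb (N + ζ)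
      rw [abs_of_pos (by linarith)] at this
      linarith
    have p1 : N ^ (2 * l) ≤ P * jb (N + ζ) ^ (2 * l) :=
      rpow_comp hN0 (jb_pos _) (by norm_num) b2 b1 _
    set m := N ^ 3 + σ + AiryPhase (N + ζ) with hm
    have hme : m = σ + -(3 * η) + -(3 * (ζ * N) * ζ + ζ * ζ * ζ) := by
      rw [hm, ← hζη]; unfold AiryPhase; ring
    have hmabs : |m| ≤ 8 := by
      rw [hme]
      have t1 : |ζ * N * ζ| ≤ 1 := by
        rw [abs_mul]; exact mul_le_one₀ hζN (abs_nonneg _) hζ1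
      have t2 : |ζ * ζ * ζ| ≤ 1 := by
        rw [abs_mul, abs_mul]
        exact mul_le_one₀ (mul_le_one₀ hζ1 (abs_nonneg _) hζ1) (abs_nonneg _) hζ1
      rw [abs_le] at *
      constructor <;> nlinarith
    have p2 : 1 ≤ Q * jb m ^ (2 * b) := by
      have := rpow_comp one_pos (jb_pos m) (K := 9) (by norm_num) (by linarith [jb_one_le m])
        (by linarith [jb_le m]) (2 * b)
      rwa [Real.one_rpow] at this
    have en : ‖2 * (Real.pi : ℂ) * Complex.I * ((N + ζ : ℝ) : ℂ) * (((N ^ 2 : ℝ) : ℂ) * 𝓕 χ η * 𝓕 χ σ)‖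
        = 2 * Real.pi * (N + ζ) * (N ^ 2 * ‖𝓕 χ η‖ * ‖𝓕 χ σ‖) := by
      simp only [norm_mul, Complex.norm_real, Complex.norm_I, Real.norm_eq_abs,
        abs_of_pos Real.pi_pos, abs_of_pos hM0, abs_of_pos (show 0 < N + ζ by linarith)]
      simp
    rw [en]
    have hpi : N / 2 ≤ 2 * Real.pi * (N + ζ) := by nlinarith [Real.pi_gt_three]
    have q1 : P⁻¹ * N ^ (2 * l) ≤ jb (N + ζ) ^ (2 * l) := by
      rw [inv_mul_le_iff₀ hP0]; exact p1
    have q2 : Q⁻¹ ≤ jb m ^ (2 * b) := by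
      rw [inv_le_iff_one_le_mul₀' hQ0]; exact p2
    have hj1 := jb_pos (N + ζ)
    have hj2 := jb_pos m
    have hpi0 : 0 ≤ 2 * Real.pi * (N + ζ) := by linarith
    calc _ = (P⁻¹ * N ^ (2 * l)) * Q⁻¹ * (N / 2 * (N ^ 2 * c * c)) ^ 2 := by ring
      _ ≤ _ := by gcongr
  calc ENNReal.ofReal (P⁻¹ * Q⁻¹ * c ^ 4 / 4 * (2 * δ) ^ 2 * N ^ (2 * l) * N ^ 4)
      = ENNReal.ofReal (N ^ 2)⁻¹ *
        (ENNReal.ofReal (P⁻¹ * Q⁻¹ * c ^ 4 / 4 * N ^ (2 * l) * N ^ 6) * volume S) := by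
        rw [hvol, ← ENNReal.ofReal_mul (by positivity), ← ENNReal.ofReal_mul (by positivity)]
        congr 1
        field_simp
    _ ≤ _ := by
        gcongr
        rw [← setLIntegral_const]
        exact (setLIntegral_mono' hSm key).trans (setLIntegral_le_lintegral _ _)

/-- failure of the bilinear estimate
`‖∂ₓ(u₁ū₂)‖_{Y_{l,b₁}} ≲ ‖u₁‖_{X_{s,b₂}}‖u₂‖_{X_{s,b₃}}` when `l > 4s`. -/
theorem stmt15 (s l : ℝ) (hl : 4 * s < l) (b₁ b₂ b₃ : ℝ) :
    ¬ ∃ C : ℝ, 0 < C ∧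
      ∀ u₁ u₂ : SchwartzMap (ℝ × ℝ) ℂ,
        XNorm AiryPhase l b₁ (partialX fun p => u₁ p * (starRingEnd ℂ) (u₂ p)) ≤
          ENNReal.ofReal C * XNorm SchPhase s b₂ ⇑u₁ * XNorm SchPhase s b₃ ⇑u₂ := by
  rintro ⟨C, hC, H⟩
  let B : ContDiffBump (0 : ℝ) := ⟨1, 2, one_pos, one_lt_two⟩
  let g : ℝ → ℝ := B
  have hg : ContDiff ℝ (⊤ : ℕ∞) g := B.contDiff
  have hgc : HasCompactSupport g := B.hasCompactSupport
  have hχ : ContDiff ℝ (⊤ : ℕ∞) (fun x => (g x : ℂ)) := Complex.ofRealCLM.contDiff.comp hg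
  have hχc : HasCompactSupport (fun x => (g x : ℂ)) := hgc.comp_left Complex.ofReal_zero
  have hχ2 : ContDiff ℝ (⊤ : ℕ∞) (fun x => ((g x ^ 2 : ℝ) : ℂ)) :=
    Complex.ofRealCLM.contDiff.comp (hg.pow 2)
  have hχ2c : HasCompactSupport (fun x => ((g x ^ 2 : ℝ) : ℂ)) :=
    hgc.comp_left (g := fun y : ℝ => ((y ^ 2 : ℝ) : ℂ)) (by simp)
  have h0 : 𝓕 (fun x => ((g x ^ 2 : ℝ) : ℂ)) 0 ≠ 0 := by
    rw [four_eq]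
    simp only [Complex.ofReal_zero, mul_zero, neg_zero, zero_mul, Complex.exp_zero, one_mul]
    rw [integral_complex_ofReal]
    have hc : Continuous (fun x => g x ^ 2) := (hg.continuous.pow 2)
    have hcs : HasCompactSupport (fun x => g x ^ 2) :=
      hgc.comp_left (g := fun y : ℝ => y ^ 2) (by simp)
    have := hc.integral_pos_of_hasCompactSupport_nonneg_nonzero (μ := volume) (x := 0) hcs
      (fun x => sq_nonneg _) (by
        have : g 0 = 1 := B.one_of_mem_closedBall (by simp [B])
        simp [this])
    exact_mod_cast this.ne'
  obtain ⟨K₁, hK₁, U₁⟩ := upper hχ hχc s b₂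
  obtain ⟨K₂, hK₂, U₂⟩ := upper hχ hχc s b₃
  obtain ⟨k, hk, L⟩ := lower hχ2 hχ2c h0 l b₁
  set R : ℝ := 4 ^ |2 * s| with hR
  have hR0 : 0 < R := by positivity
  have main : ∀ N : ℝ, 2 ≤ N → N ^ (2 * l - 8 * s) ≤ C ^ 2 * K₁ * K₂ * R ^ 2 / k := by
    intro N hN
    have hN0 : 0 < N := by linarith
    have hM0 : 0 < N ^ 2 := by positivity
    have hM1 : 1 ≤ N ^ 2 := by nlinarith
    set a₁ := (N - N ^ 2) / 2 with ha₁
    set a₂ := (-N ^ 2 - N) / 2 with ha₂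
    have A₁ : |a₁| = (N ^ 2 - N) / 2 := by
      rw [abs_of_nonpos (by nlinarith)]; rw [ha₁]; ring
    have A₂ : |a₂| = (N ^ 2 + N) / 2 := by
      rw [abs_of_nonpos (by nlinarith)]; rw [ha₂]; ring
    have jbb : ∀ a, N ^ 2 / 4 ≤ |a| → |a| ≤ N ^ 2 → jb a ^ (2 * s) ≤ R * N ^ (4 * s) := by
      intro a h1 h2
      have := rpow_comp (jb_pos a) hM0 (K := 4) (by norm_num) (by linarith [jb_le a])
        (by linarith [abs_le_jb a]) (2 * s)
      refine this.trans_eq ?_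
      rw [← hR, ← Real.rpow_natCast, ← Real.rpow_mul hN0.le]
      congr 2
      push_cast; ring
    have j₁ := jbb a₁ (by rw [A₁]; nlinarith) (by rw [A₁]; nlinarith)
    have j₂ := jbb a₂ (by rw [A₂]; nlinarith) (by rw [A₂]; nlinarith)
    have u₁ := U₁ (N ^ 2) a₁ hM1 (by rw [A₁]; nlinarith)
    have u₂ := U₂ (N ^ 2) a₂ hM1 (by rw [A₂]; nlinarith)
    have hH := H ((comp_pk hχc hM0 a₁ (-a₁ ^ 2)).toSchwartzMap (contDiff_pk hχ _ _ _))
      ((comp_pk hχc hM0 a₂ (-a₂ ^ 2)).toSchwartzMap (contDiff_pk hχ _ _ _))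
    have ep : (fun p => pk (fun x => (g x : ℂ)) (N ^ 2) a₁ (-a₁ ^ 2) p *
        (starRingEnd ℂ) (pk (fun x => (g x : ℂ)) (N ^ 2) a₂ (-a₂ ^ 2) p))
        = pk (fun x => ((g x ^ 2 : ℝ) : ℂ)) (N ^ 2) N (N ^ 3) := by
      funext p
      rw [pk_mul_conj]
      congr 1
      · rw [ha₁, ha₂]; ring
      · rw [ha₁, ha₂]; ring
    change XNorm AiryPhase l b₁ (partialX (fun p => pk (fun x => (g x : ℂ)) (N ^ 2) a₁ (-a₁ ^ 2) p *
        (starRingEnd ℂ) (pk (fun x => (g x : ℂ)) (N ^ 2) a₂ (-a₂ ^ 2) p))) ≤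
        ENNReal.ofReal C * XNorm SchPhase s b₂ (pk (fun x => (g x : ℂ)) (N ^ 2) a₁ (-a₁ ^ 2)) *
        XNorm SchPhase s b₃ (pk (fun x => (g x : ℂ)) (N ^ 2) a₂ (-a₂ ^ 2)) at hH
    rw [ep] at hH
    have hall := (L N hN).trans (hH.trans (mul_le_mul' (mul_le_mul' le_rfl u₁) u₂))
    have jp₁ := jb_pos a₁
    have jp₂ := jb_pos a₂
    rw [← ENNReal.ofReal_mul hC.le, ← ENNReal.ofReal_mul (by positivity),
      ENNReal.ofReal_le_ofReal_iff (by positivity)] at hall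
    have hsq := pow_le_pow_left₀ (by positivity) hall 2
    rw [mul_pow, mul_pow, Real.sq_sqrt (by positivity), Real.sq_sqrt (by positivity),
      Real.sq_sqrt (by positivity)] at hsq
    have hsq2 : k * N ^ (2 * l) * N ^ 4 ≤
        C ^ 2 * (N ^ 2 * K₁ * (R * N ^ (4 * s))) * (N ^ 2 * K₂ * (R * N ^ (4 * s))) := by
      refine hsq.trans ?_
      gcongr
    have e8 : N ^ (8 * s) = N ^ (4 * s) * N ^ (4 * s) := by
      rw [← Real.rpow_add hN0]; congr 1; ring
    rw [Real.rpow_sub hN0, e8, le_div_iff₀ hk, div_mul_eq_mul_div, div_le_iff₀ (by positivity)]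
    have hN4 : 0 < N ^ 4 := by positivity
    refine le_of_mul_le_mul_right ?_ hN4
    calc _ = k * N ^ (2 * l) * N ^ 4 := by ring
      _ ≤ _ := hsq2
      _ = _ := by ring
  have ht := tendsto_rpow_atTop (show 0 < 2 * l - 8 * s by linarith)
  obtain ⟨N, hN1, hN2⟩ := ((ht.eventually_gt_atTop (C ^ 2 * K₁ * K₂ * R ^ 2 / k)).and
    (Filter.eventually_ge_atTop 2)).exists
  exact absurd (main N hN2) (not_le.2 hN1)

end
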